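/- If R is an rc-graph satisfying condition (*) (no two strands of R with nonpositive labels intersect) and 1 ≤ k ≤ n, then the rc-graph R ← k also satisfies condition (*): no two strands of R ← k with nonpositive labels intersect, equivalently w_{R←k}(i) > w_{R←k}(i−1) for all i ≤ 0. -/

import Mathlib

open scoped Classical

noncomputable section

namespace RCGraphs

/-- The simple transposition `s j`, interchanging `j` and `j+1`. -/
def sT (j : ℤ) : Equiv.Perm ℤ := Equiv.swap j (j + 1)

/-- The Coxeter length of a permutation of `ℤ`: the minimal length of an expression
as a product of simple transpositions. -/
def len (w : Equiv.Perm ℤ) : ℕ :=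
  sInf {m : ℕ | ∃ l : List ℤ, l.length = m ∧ (l.map sT).prod = w}

/-- The permutations considered in the paper: bijections of `ℤ` fixing every `i > n`
and fixing all sufficiently small integers. -/
def IsPermZ (n : ℤ) (w : Equiv.Perm ℤ) : Prop :=
  (∀ i : ℤ, n < i → w i = i) ∧ ∃ N : ℤ, ∀ i : ℤ, i < N → w i = i

/-- The reading order on positions `(i,k)`: rows (second coordinate) from `n` downward,
and within a row in order of increasing first coordinate. -/
def rcOrder (p q : ℤ × ℤ) : Prop :=
  q.2 < p.2 ∨ (p.2 = q.2 ∧ p.1 ≤ q.1)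

instance : DecidableRel rcOrder := fun p q => by
  unfold rcOrder; infer_instance

instance : IsTrans (ℤ × ℤ) rcOrder :=
  ⟨fun a b c h₁ h₂ => by unfold rcOrder at *; omega⟩

instance : IsAntisymm (ℤ × ℤ) rcOrder :=
  ⟨fun a b h₁ h₂ => by
    unfold rcOrder at *
    have h3 : a.1 = b.1 ∧ a.2 = b.2 := by omega
    exact Prod.ext h3.1 h3.2⟩

instance : IsTotal (ℤ × ℤ) rcOrder :=
  ⟨fun a b => by unfold rcOrder; omega⟩

/-- The permutation `w_R` associated to a finite set of positions `R`: the product of the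
simple transpositions `s_{i+k-n-1}`, `(i,k) ∈ R`, in the reading order. -/
def wR (n : ℤ) (R : Finset (ℤ × ℤ)) : Equiv.Perm ℤ :=
  ((R.sort rcOrder).map fun p => sT (p.1 + p.2 - n - 1)).prod

/-- `R` is an rc-graph: positions lie in the grid `{(i,k) : i ≤ n, k ≤ n}` and the
reading word is reduced. -/
def IsRC (n : ℤ) (R : Finset (ℤ × ℤ)) : Prop :=
  (∀ p ∈ R, p.1 ≤ n ∧ p.2 ≤ n) ∧ len (wR n R) = R.card

/-- Condition (*): `w_R(i) > w_R(i-1)` for all `i ≤ 0`; equivalently no two strands with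
nonpositive labels cross. -/
def Star (n : ℤ) (R : Finset (ℤ × ℤ)) : Prop :=
  ∀ i : ℤ, i ≤ 0 → wR n R (i - 1) < wR n R i

/-- Strand labels in the wiring diagram of `R` (for diagrams all of whose crossings lie in
rows `k ≥ 1`, as is the case under condition (*)).  `lab n R true i k` is the label of the
strand entering position `(i,k)` from the west (the strand passing above, if `(i,k)` is not
a crossing); `lab n R false i k` is the label of the strand entering from the south (the
strand passing below).  Each strand is labeled by the row where it begins. -/
def lab (n : ℤ) (R : Finset (ℤ × ℤ)) : Bool → ℤ → ℤ → ℤ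
  | true, i, k =>
      if h : n ≤ i then k
      else if (i + 1, k) ∈ R then lab n R true (i + 1) k else lab n R false (i + 1) k
  | false, i, k =>
      if h : k ≤ 0 then i + k - n - 1
      else if (i, k - 1) ∈ R then lab n R false i (k - 1) else lab n R true i (k - 1)
  termination_by b i k => ((n - i).toNat + k.toNat)
  decreasing_by
    all_goals simp_wf
    all_goals omega

/-- The label of the strand leaving position `(i,r)` northward. -/
def northLabel (n : ℤ) (R : Finset (ℤ × ℤ)) (i r : ℤ) : ℤ :=
  if (i, r) ∈ R then lab n R false i r else lab n R true i r

/-- `(i,k)` is an open space: not a crossing, the strand passing below it has a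
nonpositive label and the strand passing above it has a positive label. -/
def OpenSpace (n : ℤ) (R : Finset (ℤ × ℤ)) (i k : ℤ) : Prop :=
  i ≤ n ∧ (i, k) ∉ R ∧ lab n R false i k ≤ 0 ∧ 0 < lab n R true i k

/-- The main loop of the Bergeron--Billey insertion algorithm, recording the trace:
the list of pairs (current diagram, crossing just added).  `R` always contains the
crossing `p` that was just added. -/
def insertSteps (n : ℤ) : ℕ → Finset (ℤ × ℤ) → ℤ × ℤ → List (Finset (ℤ × ℤ) × (ℤ × ℤ))
  | 0, _, _ => []
  | fuel + 1, R, p =>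
      (R, p) ::
        if IsRC n R then []
        else
          let a := lab n R true p.1 p.2
          let b := lab n R false p.1 p.2
          -- the unique other crossing of the two strands that cross at `p`
          let C := R.filter fun q =>
            q ≠ p ∧ ((lab n R true q.1 q.2 = a ∧ lab n R false q.1 q.2 = b) ∨
                     (lab n R true q.1 q.2 = b ∧ lab n R false q.1 q.2 = a))
          let q := (C.sort rcOrder).headI
          let R' := R.erase q
          let i' := sInf {x : ℤ | q.1 < x ∧ OpenSpace n R' x q.2}
          insertSteps n fuel (insert (i', q.2) R') (i', q.2)

/-- The trace of the insertion of `k` into `R`: the states of the algorithm together with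
the crossings added at each step. -/
def insertStepsOf (n : ℤ) (R : Finset (ℤ × ℤ)) (k : ℤ) : List (Finset (ℤ × ℤ) × (ℤ × ℤ)) :=
  let i₁ := sInf {x : ℤ | OpenSpace n R x k}
  insertSteps n ((n + 1 - k).toNat + 1) (insert (i₁, k) R) (i₁, k)

/-- The insertion `R ← k` of Bergeron and Billey. -/
def insertOne (n : ℤ) (R : Finset (ℤ × ℤ)) (k : ℤ) : Finset (ℤ × ℤ) :=
  ((insertStepsOf n R k).getLast?.getD (R, (0, 0))).1

/-- The insertion `R ← v` of a word. -/
def insertWord (n : ℤ) (R : Finset (ℤ × ℤ)) (v : List ℕ) : Finset (ℤ × ℤ) :=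
  v.foldl (fun S a => insertOne n S (a : ℤ)) R

/-- The column (first coordinate) at which the strand labeled `a` of the diagram `R`
leaves row `r` northward. -/
def strandCol (n : ℤ) (R : Finset (ℤ × ℤ)) (a r : ℤ) : ℤ :=
  sSup {i : ℤ | i ≤ n ∧ northLabel n R i r = a}

/-- Given the trace `L` of an insertion, the column occupied in row `r` by the left path
(`left = true`) or the right path (`left = false`) of the insertion.  Between the rows of
the `t`-th and `(t+1)`-st added crossings, the left path is the piece `s_t` of the strand
whose label changes from `a_t` to `b_t`, and the right path is the piece `s^t` whose label
changes from `b_t` to `a_t`. -/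
def pathCol (n : ℤ) (L : List (Finset (ℤ × ℤ) × (ℤ × ℤ))) (left : Bool) (r : ℤ) : ℤ :=
  match (L.filter fun e => e.2.2 ≤ r).getLast? with
  | some e => strandCol n e.1 (lab n e.1 left e.2.1 e.2.2) r
  | none => 0

/-- A semistandard Young tableau with at most `n` rows (rows indexed `1,…,n`, row `j`
having `μ j` boxes, columns indexed from `0`), with entries in `{1,…,n}`, weakly
increasing along rows and strictly increasing down columns; entries outside the shape
are `0`. -/
structure SSYT (n : ℕ) (μ : ℕ → ℕ) where
  entry : ℕ → ℕ → ℕ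
  entry_mem : ∀ j c, 1 ≤ j → j ≤ n → c < μ j → 1 ≤ entry j c ∧ entry j c ≤ n
  row_weak : ∀ j c₁ c₂, 1 ≤ j → j ≤ n → c₁ ≤ c₂ → c₂ < μ j → entry j c₁ ≤ entry j c₂
  col_strict : ∀ j₁ j₂ c, 1 ≤ j₁ → j₁ < j₂ → j₂ ≤ n → c < μ j₂ → entry j₁ c < entry j₂ c
  outside : ∀ j c, j = 0 ∨ n < j ∨ μ j ≤ c → entry j c = 0

/-- `μ` is a partition with (at most) `n` parts `μ 1 ≥ μ 2 ≥ … ≥ μ n ≥ 0`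
(and `μ j = 0` outside `1,…,n`). -/
def IsPartition (n : ℕ) (μ : ℕ → ℕ) : Prop :=
  (∀ j, 1 ≤ j → j < n → μ (j + 1) ≤ μ j) ∧ ∀ j, j = 0 ∨ n < j → μ j = 0

/-- The reading word of a tableau: the rows read left to right, from the bottom row
to the top one. -/
def readingWord (n : ℕ) (μ : ℕ → ℕ) (Y : SSYT n μ) : List ℕ :=
  ((List.range n).reverse.map (· + 1)).flatMap fun j =>
    (List.range (μ j)).map fun c => Y.entry j c

/-- An elementary Knuth move. -/
def KnuthMove (w₁ w₂ : List ℕ) : Prop :=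
  (∃ (u v : List ℕ) (x y z : ℕ), x < y ∧ y ≤ z ∧
      w₁ = u ++ y :: x :: z :: v ∧ w₂ = u ++ y :: z :: x :: v) ∨
  (∃ (u v : List ℕ) (x y z : ℕ), x ≤ y ∧ y < z ∧
      w₁ = u ++ x :: z :: y :: v ∧ w₂ = u ++ z :: x :: y :: v)

/-- Knuth equivalence: the equivalence relation generated by elementary Knuth moves. -/
def KnuthEquiv (w₁ w₂ : List ℕ) : Prop := Relation.EqvGen KnuthMove w₁ w₂

/-- The monomial `x^R = ∏_{(i,k) ∈ R} x_k`. -/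
def xR (R : Finset (ℤ × ℤ)) : MvPolynomial ℕ ℤ :=
  ∏ p ∈ R, MvPolynomial.X p.2.toNat

/-- The monomial `x^Y = ∏ x_i`, one factor for each entry `i` of `Y`. -/
def xY (n : ℕ) (μ : ℕ → ℕ) (Y : SSYT n μ) : MvPolynomial ℕ ℤ :=
  ((readingWord n μ Y).map MvPolynomial.X).prod

/-- The Schubert polynomial `S_w = Σ_{R : w_R = w} x^R`. -/
def Schub (n : ℤ) (w : Equiv.Perm ℤ) : MvPolynomial ℕ ℤ :=
  ∑ᶠ R ∈ {R : Finset (ℤ × ℤ) | IsRC n R ∧ wR n R = w}, xR R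

/-- The Schur polynomial `s_μ(x₁,…,x_n) = Σ_Y x^Y`, summing over all semistandard Young
tableaux of shape `μ` with entries in `{1,…,n}`. -/
def SchurP (n : ℕ) (μ : ℕ → ℕ) : MvPolynomial ℕ ℤ :=
  ∑ᶠ Y : SSYT n μ, xY n μ Y

/-- The complete homogeneous symmetric polynomial
`h_m = Σ_{1 ≤ i₁ ≤ … ≤ i_m ≤ n} x_{i₁} ⋯ x_{i_m}`. -/
def hPoly (n m : ℕ) : MvPolynomial ℕ ℤ :=
  ∑ s ∈ (Finset.Icc 1 n).sym m, (s.1.map MvPolynomial.X).prod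

/-- The top rc-graph `R(μ) = {(i,k) : 1 ≤ k ≤ n, n - μ_k + 1 ≤ i ≤ n}` of a partition. -/
def Rmu (n : ℕ) (μ : ℕ → ℕ) : Finset (ℤ × ℤ) :=
  (Finset.Icc 1 (n : ℤ)).biUnion fun k =>
    (Finset.Icc ((n : ℤ) - μ k.toNat + 1) (n : ℤ)).image fun i => (i, k)


/-- Strict reading order. -/
def ltR (x y : ℤ × ℤ) : Prop := y.2 < x.2 ∨ (x.2 = y.2 ∧ x.1 < y.1)

/-- The crossings met strictly before `x` by the strands. -/
def bef (R : Finset (ℤ × ℤ)) (x : ℤ × ℤ) : Finset (ℤ × ℤ) := R.filter fun y => ltR x y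

def idx (n : ℤ) (p : ℤ × ℤ) : ℤ := p.1 + p.2 - n - 1

def lT (n : ℤ) (R : Finset (ℤ × ℤ)) (x : ℤ × ℤ) : ℤ := (wR n (bef R x)).symm (idx n x + 1)
def lF (n : ℤ) (R : Finset (ℤ × ℤ)) (x : ℤ × ℤ) : ℤ := (wR n (bef R x)).symm (idx n x)

theorem ltR_trans {x y z : ℤ × ℤ} (h : ltR x y) (h' : ltR y z) : ltR x z := by
  unfold ltR at *; omega

theorem ltR_irrefl (x : ℤ × ℤ) : ¬ ltR x x := by
  unfold ltR; omega

theorem ltR_tri (x y : ℤ × ℤ) : ltR x y ∨ x = y ∨ ltR y x := by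
  unfold ltR
  by_cases h : x.1 = y.1 ∧ x.2 = y.2
  · right; left; exact Prod.ext h.1 h.2
  · omega

theorem rcOrder_of_ltR {x y : ℤ × ℤ} (h : ltR x y) : rcOrder x y := by
  unfold ltR at h; unfold rcOrder; omega

theorem wR_union (n : ℤ) (A B : Finset (ℤ × ℤ)) (h : ∀ a ∈ A, ∀ b ∈ B, ltR a b) :
    wR n (A ∪ B) = wR n A * wR n B := by
  have hnd : (A.sort rcOrder ++ B.sort rcOrder).Nodup := by
    rw [List.nodup_append]
    refine ⟨Finset.sort_nodup _ _, Finset.sort_nodup _ _, ?_⟩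
    intro a ha b hb hab
    subst hab
    exact ltR_irrefl a (h a (by simpa using ha) a (by simpa using hb))
  have hp : (A.sort rcOrder ++ B.sort rcOrder).Pairwise rcOrder := by
    rw [List.pairwise_append]
    refine ⟨Finset.pairwise_sort _ _, Finset.pairwise_sort _ _, ?_⟩
    intro a ha b hb
    exact rcOrder_of_ltR (h a (by simpa using ha) b (by simpa using hb))
  have := (List.toFinset_sort rcOrder hnd).2 hp
  rw [List.toFinset_append, Finset.sort_toFinset, Finset.sort_toFinset] at this
  unfold wR
  rw [this]
  simp

theorem wR_single (n : ℤ) (q : ℤ × ℤ) : wR n {q} = sT (idx n q) := by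
  simp [wR, idx]

theorem wR_empty (n : ℤ) : wR n ∅ = 1 := by
  simp [wR]

theorem wR_split (n : ℤ) (R : Finset (ℤ × ℤ)) (y : ℤ × ℤ) :
    wR n R = wR n (R.filter fun z => ltR z y) * (if y ∈ R then sT (idx n y) else 1) *
      wR n (bef R y) := by
  have key : R = (R.filter fun z => ltR z y) ∪ (if y ∈ R then {y} else ∅) ∪ bef R y := by
    ext z
    have := ltR_tri z y
    simp only [bef, Finset.mem_union, Finset.mem_filter]
    split_ifs with hy
    · simp only [Finset.mem_singleton]
      constructor
      · tauto
      · rintro ((h | h) | h)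
        · tauto
        · subst h; exact hy
        · tauto
    · have : z ∈ R → z ≠ y := by rintro h rfl; exact hy h
      simp only [Finset.notMem_empty]
      tauto
  conv_lhs => rw [key]
  rw [wR_union, wR_union]
  · congr 2
    split_ifs
    · exact wR_single n y
    · exact wR_empty n
  · intro a ha b hb
    split_ifs at hb
    · simp only [Finset.mem_singleton, Finset.mem_filter] at ha hb
      subst hb; exact ha.2
    · simp at hb
  · intro a ha b hb
    simp only [bef, Finset.mem_union, Finset.mem_filter] at ha hb
    split_ifs at ha
    · simp only [Finset.mem_singleton] at ha
      rcases ha with ha | ha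
      · exact ltR_trans ha.2 hb.2
      · subst ha; exact hb.2
    · simp only [Finset.notMem_empty, or_false] at ha
      exact ltR_trans ha.2 hb.2

theorem bef_bef (R : Finset (ℤ × ℤ)) {x y : ℤ × ℤ} (h : ltR x y) :
    bef (bef R x) y = bef R y := by
  ext z
  simp only [bef, Finset.mem_filter]
  constructor
  · tauto
  · rintro ⟨h1, h2⟩; exact ⟨⟨h1, ltR_trans h h2⟩, h2⟩

theorem wR_bef_split (n : ℤ) (R : Finset (ℤ × ℤ)) {x y : ℤ × ℤ} (h : ltR x y) :
    wR n (bef R x) = wR n (R.filter fun z => ltR x z ∧ ltR z y) *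
      (if y ∈ R then sT (idx n y) else 1) * wR n (bef R y) := by
  rw [wR_split n (bef R x) y, bef_bef R h]
  congr 2
  · congr 1
    simp [bef, Finset.filter_filter]
  · simp [bef, h]

theorem wR_fix (n : ℤ) (A : Finset (ℤ × ℤ)) (j : ℤ)
    (h : ∀ p ∈ A, idx n p ≠ j ∧ idx n p + 1 ≠ j) : wR n A j = j := by
  unfold wR
  have h' : ∀ p ∈ A.sort rcOrder, idx n p ≠ j ∧ idx n p + 1 ≠ j := by
    intro p hp; exact h p (by simpa using hp)
  revert h'
  generalize A.sort rcOrder = l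
  induction l with
  | nil => simp
  | cons p l ih =>
    intro h'
    simp only [List.map_cons, List.prod_cons, Equiv.Perm.mul_apply]
    rw [ih (fun q hq => h' q (List.mem_cons_of_mem _ hq))]
    have := h' p (by simp)
    unfold idx at this
    exact Equiv.swap_apply_of_ne_of_ne (Ne.symm this.1) (Ne.symm this.2)

theorem wR_fix_symm (n : ℤ) (A : Finset (ℤ × ℤ)) (j : ℤ)
    (h : ∀ p ∈ A, idx n p ≠ j ∧ idx n p + 1 ≠ j) : (wR n A).symm j = j := by
  rw [Equiv.symm_apply_eq, wR_fix n A j h]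

theorem wR_insert (n : ℤ) (R : Finset (ℤ × ℤ)) (q : ℤ × ℤ) (hq : q ∉ R) :
    wR n (insert q R) = wR n R * Equiv.swap (lT n R q) (lF n R q) := by
  have e1 : bef (insert q R) q = bef R q := by
    simp [bef, Finset.filter_insert, ltR_irrefl]
  have e2 : ((insert q R).filter fun z => ltR z q) = R.filter fun z => ltR z q := by
    simp [Finset.filter_insert, ltR_irrefl]
  rw [wR_split n (insert q R) q, wR_split n R q, e1, e2]
  simp only [Finset.mem_insert_self, if_true, hq, if_false, mul_one, mul_assoc]
  congr 1
  unfold lT lF sT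
  rw [Equiv.Perm.mul_def, Equiv.Perm.mul_def, Equiv.swap_comm (idx n q)]
  ext z
  simp only [Equiv.trans_apply, Equiv.swap_apply_def]
  split_ifs <;> simp_all [Equiv.eq_symm_apply]

def Good (n : ℤ) (R : Finset (ℤ × ℤ)) : Prop := ∀ p ∈ R, p.1 ≤ n ∧ 1 ≤ p.2 ∧ p.2 ≤ n

theorem lT_of_le (n : ℤ) (R : Finset (ℤ × ℤ)) (hG : Good n R) (k : ℤ) : lT n R (n, k) = k := by
  unfold lT
  rw [wR_fix_symm]
  · unfold idx; dsimp; omega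
  · intro p hp
    rw [bef, Finset.mem_filter] at hp
    unfold ltR at hp
    have := hG p hp.1
    unfold idx; dsimp only at *; omega

theorem lF_of_le (n : ℤ) (R : Finset (ℤ × ℤ)) (hG : Good n R) (i k : ℤ) (hk : k ≤ 0) :
    lF n R (i, k) = i + k - n - 1 := by
  unfold lF
  rw [wR_fix_symm]
  · rfl
  · intro p hp
    rw [bef, Finset.mem_filter] at hp
    unfold ltR at hp
    have := hG p hp.1
    dsimp only at *; omega

theorem lT_step (n : ℤ) (R : Finset (ℤ × ℤ)) (i k : ℤ) :
    lT n R (i, k) = if (i + 1, k) ∈ R then lT n R (i + 1, k) else lF n R (i + 1, k) := by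
  have hl : ltR (i, k) (i + 1, k) := by unfold ltR; dsimp; omega
  have he : (R.filter fun z => ltR (i, k) z ∧ ltR z (i + 1, k)) = ∅ := by
    apply Finset.filter_eq_empty_iff.2
    intro z _
    unfold ltR; dsimp; omega
  have h1 : idx n (i + 1, k) = idx n (i, k) + 1 := by unfold idx; dsimp; omega
  unfold lT lF
  rw [wR_bef_split n R hl, he, wR_empty, one_mul, h1]
  split_ifs
  · rw [Equiv.symm_apply_eq, Equiv.Perm.mul_apply, Equiv.apply_symm_apply]
    simp [sT]
  · rw [one_mul]

theorem lF_step (n : ℤ) (R : Finset (ℤ × ℤ)) (i k : ℤ) :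
    lF n R (i, k) = if (i, k - 1) ∈ R then lF n R (i, k - 1) else lT n R (i, k - 1) := by
  have hl : ltR (i, k) (i, k - 1) := by unfold ltR; dsimp; omega
  have h1 : idx n (i, k) = idx n (i, k - 1) + 1 := by unfold idx; dsimp; omega
  have hf : wR n (R.filter fun z => ltR (i, k) z ∧ ltR z (i, k - 1)) (idx n (i, k)) =
      idx n (i, k) := by
    apply wR_fix
    intro p hp
    rw [Finset.mem_filter] at hp
    unfold ltR at hp
    unfold idx; dsimp only at *; omega
  unfold lF lT
  rw [wR_bef_split n R hl]
  split_ifs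
  · rw [Equiv.symm_apply_eq, Equiv.Perm.mul_apply, Equiv.Perm.mul_apply,
      Equiv.apply_symm_apply]
    simp only [sT, Equiv.swap_apply_left]
    rw [← h1, hf]
  · rw [Equiv.symm_apply_eq, mul_one, Equiv.Perm.mul_apply, ← h1,
      Equiv.apply_symm_apply, hf]

theorem lab_eq_aux (n : ℤ) (R : Finset (ℤ × ℤ)) (hG : Good n R) (m : ℕ) :
    ∀ i k : ℤ, i ≤ n → (n - i).toNat + k.toNat = m →
      lab n R true i k = lT n R (i, k) ∧ lab n R false i k = lF n R (i, k) := by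
  induction m with
  | zero =>
    intro i k hi hm
    have h1 : i = n := by omega
    have h2 : k ≤ 0 := by omega
    constructor
    · rw [lab.eq_1, dif_pos h1.ge, h1, lT_of_le n R hG k]
    · rw [lab.eq_2, dif_pos h2, lF_of_le n R hG i k h2]
  | succ m ih =>
    intro i k hi hm
    constructor
    · rw [lab.eq_1]
      split_ifs with h1 h2
      · have : i = n := by omega
        rw [this, lT_of_le n R hG k]
      · rw [lT_step, if_pos h2]; exact (ih (i + 1) k (by omega) (by omega)).1
      · rw [lT_step, if_neg h2]; exact (ih (i + 1) k (by omega) (by omega)).2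
    · rw [lab.eq_2]
      split_ifs with h1 h2
      · rw [lF_of_le n R hG i k h1]
      · rw [lF_step, if_pos h2]; exact (ih i (k - 1) (by omega) (by omega)).2
      · rw [lF_step, if_neg h2]; exact (ih i (k - 1) (by omega) (by omega)).1

theorem lab_true (n : ℤ) (R : Finset (ℤ × ℤ)) (hG : Good n R) (i k : ℤ) (hi : i ≤ n) :
    lab n R true i k = lT n R (i, k) := (lab_eq_aux n R hG _ i k hi rfl).1

theorem lab_false (n : ℤ) (R : Finset (ℤ × ℤ)) (hG : Good n R) (i k : ℤ) (hi : i ≤ n) :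
    lab n R false i k = lF n R (i, k) := (lab_eq_aux n R hG _ i k hi rfl).2

/-! Length and the exchange property -/

theorem len_le_of (l : List ℤ) : len (l.map sT).prod ≤ l.length :=
  Nat.sInf_le ⟨l, rfl, rfl⟩

theorem wR_word (n : ℤ) (R : Finset (ℤ × ℤ)) :
    ∃ l : List ℤ, l.length = R.card ∧ (l.map sT).prod = wR n R :=
  ⟨(R.sort rcOrder).map (idx n), by simp, by simp [wR, idx, Function.comp_def]⟩

theorem len_wR_le (n : ℤ) (R : Finset (ℤ × ℤ)) : len (wR n R) ≤ R.card := by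
  obtain ⟨l, h1, h2⟩ := wR_word n R
  rw [← h1, ← h2]; exact len_le_of l

theorem len_word (n : ℤ) (R : Finset (ℤ × ℤ)) :
    ∃ l : List ℤ, l.length = len (wR n R) ∧ (l.map sT).prod = wR n R := by
  obtain ⟨l, h1, h2⟩ := wR_word n R
  exact Nat.sInf_mem (s := {m : ℕ | ∃ l : List ℤ, l.length = m ∧ (l.map sT).prod = wR n R})
    ⟨_, l, rfl, h2⟩

theorem sT_flip {j x y : ℤ} (h : x < y) (h' : sT j y < sT j x) : x = j ∧ y = j + 1 := by
  unfold sT at h'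
  rw [Equiv.swap_apply_def, Equiv.swap_apply_def] at h'
  split_ifs at h' <;> omega

theorem exchange (l : List ℤ) (a b : ℤ) (hba : b < a)
    (h : (l.map sT).prod a < (l.map sT).prod b) :
    ∃ l' : List ℤ, l'.length + 1 = l.length ∧
      (l'.map sT).prod = (l.map sT).prod * Equiv.swap a b := by
  induction l with
  | nil => simp at h; omega
  | cons j t ih =>
    simp only [List.map_cons, List.prod_cons, Equiv.Perm.mul_apply] at h
    rcases lt_trichotomy ((t.map sT).prod a) ((t.map sT).prod b) with hlt | heq | hgt
    · obtain ⟨t', h1, h2⟩ := ih hlt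
      exact ⟨j :: t', by simp [h1], by simp [h2, mul_assoc]⟩
    · have := (t.map sT).prod.injective heq
      omega
    · obtain ⟨h1, h2⟩ := sT_flip hgt h
      refine ⟨t, by simp, ?_⟩
      rw [List.map_cons, List.prod_cons, mul_assoc, Equiv.mul_swap_eq_swap_mul, h1, h2, sT,
        Equiv.swap_comm (j + 1) j, ← mul_assoc, Equiv.swap_mul_self, one_mul]

/-! Behaviour of labels under insertion of crossings -/

theorem bef_insert_not (R : Finset (ℤ × ℤ)) {x p : ℤ × ℤ} (h : ¬ ltR x p) :
    bef (insert p R) x = bef R x := by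
  simp [bef, Finset.filter_insert, h]

theorem bef_insert_later (R : Finset (ℤ × ℤ)) {x p : ℤ × ℤ} (h : ltR x p) :
    bef (insert p R) x = insert p (bef R x) := by
  simp [bef, Finset.filter_insert, h]

theorem mem_bef {R : Finset (ℤ × ℤ)} {x p : ℤ × ℤ} : p ∈ bef R x ↔ p ∈ R ∧ ltR x p := by
  simp [bef]

theorem lT_insert_not (n : ℤ) (R : Finset (ℤ × ℤ)) {x p : ℤ × ℤ} (h : ¬ ltR x p) :
    lT n (insert p R) x = lT n R x := by
  unfold lT; rw [bef_insert_not R h]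

theorem lF_insert_not (n : ℤ) (R : Finset (ℤ × ℤ)) {x p : ℤ × ℤ} (h : ¬ ltR x p) :
    lF n (insert p R) x = lF n R x := by
  unfold lF; rw [bef_insert_not R h]

theorem lT_bef (n : ℤ) (R : Finset (ℤ × ℤ)) {x p : ℤ × ℤ} (h : ltR x p) :
    lT n (bef R x) p = lT n R p := by
  unfold lT; rw [bef_bef R h]

theorem lF_bef (n : ℤ) (R : Finset (ℤ × ℤ)) {x p : ℤ × ℤ} (h : ltR x p) :
    lF n (bef R x) p = lF n R p := by
  unfold lF; rw [bef_bef R h]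

theorem wR_bef_insert (n : ℤ) (R : Finset (ℤ × ℤ)) {x p : ℤ × ℤ} (h : ltR x p) (hp : p ∉ R) :
    wR n (bef (insert p R) x) = wR n (bef R x) * Equiv.swap (lT n R p) (lF n R p) := by
  rw [bef_insert_later R h, wR_insert n _ _ (fun h' => hp (mem_bef.1 h').1), lT_bef n R h,
    lF_bef n R h]

theorem lT_insert_later (n : ℤ) (R : Finset (ℤ × ℤ)) {x p : ℤ × ℤ} (h : ltR x p) (hp : p ∉ R) :
    lT n (insert p R) x = Equiv.swap (lT n R p) (lF n R p) (lT n R x) := by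
  rw [lT, wR_bef_insert n R h hp, Equiv.symm_apply_eq, Equiv.Perm.mul_apply,
    Equiv.swap_apply_self, lT, Equiv.apply_symm_apply]

theorem lF_insert_later (n : ℤ) (R : Finset (ℤ × ℤ)) {x p : ℤ × ℤ} (h : ltR x p) (hp : p ∉ R) :
    lF n (insert p R) x = Equiv.swap (lT n R p) (lF n R p) (lF n R x) := by
  rw [lF, wR_bef_insert n R h hp, Equiv.symm_apply_eq, Equiv.Perm.mul_apply,
    Equiv.swap_apply_self, lF, Equiv.apply_symm_apply]

/-- The strands `a` and `b` pass through the position `q`. -/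
def Cr (n : ℤ) (R : Finset (ℤ × ℤ)) (q : ℤ × ℤ) (a b : ℤ) : Prop :=
  (lT n R q = a ∧ lF n R q = b) ∨ (lT n R q = b ∧ lF n R q = a)

theorem Cr.swap_eq {n : ℤ} {R : Finset (ℤ × ℤ)} {q : ℤ × ℤ} {a b : ℤ} (h : Cr n R q a b) :
    Equiv.swap (lT n R q) (lF n R q) = Equiv.swap a b := by
  rcases h with ⟨h1, h2⟩ | ⟨h1, h2⟩ <;> rw [h1, h2]
  exact Equiv.swap_comm _ _

theorem wR_erase (n : ℤ) (R : Finset (ℤ × ℤ)) {q : ℤ × ℤ} (hq : q ∈ R) {a b : ℤ}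
    (h : Cr n R q a b) : wR n (R.erase q) = wR n R * Equiv.swap a b := by
  have e := Finset.insert_erase hq
  have h1 := wR_insert n (R.erase q) q (Finset.notMem_erase q R)
  rw [e] at h1
  have hc : Cr n (R.erase q) q a b := by
    unfold Cr at *
    rw [← lT_insert_not n (R.erase q) (ltR_irrefl q), ← lF_insert_not n (R.erase q) (ltR_irrefl q),
      e]
    exact h
  rw [hc.swap_eq] at h1
  rw [h1, mul_assoc, Equiv.swap_mul_self, mul_one]

theorem uniq_aux {n : ℤ} {R : Finset (ℤ × ℤ)} (hR : IsRC n R) {q q' : ℤ × ℤ} (hq : q ∈ R)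
    (hq' : q' ∈ R) (hl : ltR q' q) {a b : ℤ} (h : Cr n R q a b) (h' : Cr n R q' a b) : False := by
  have hne : q ≠ q' := by rintro rfl; exact ltR_irrefl _ hl
  have hnl : ¬ ltR q q' := fun h => ltR_irrefl _ (ltR_trans h hl)
  have hq1 : q ∈ R.erase q' := Finset.mem_erase.2 ⟨hne, hq⟩
  have hc : Cr n (R.erase q') q a b := by
    unfold Cr at *
    rw [← lT_insert_not n (R.erase q') hnl, ← lF_insert_not n (R.erase q') hnl,
      Finset.insert_erase hq']
    exact h
  have e := wR_erase n _ hq1 hc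
  rw [wR_erase n R hq' h', mul_assoc, Equiv.swap_mul_self, mul_one] at e
  have h1 := len_wR_le n ((R.erase q').erase q)
  have h2 := Finset.card_erase_add_one hq1
  have h3 := Finset.card_erase_add_one hq'
  rw [e, hR.2] at h1
  omega

theorem uniq {n : ℤ} {R : Finset (ℤ × ℤ)} (hR : IsRC n R) {q q' : ℤ × ℤ} (hq : q ∈ R)
    (hq' : q' ∈ R) (hne : q ≠ q') {a b : ℤ} (h : Cr n R q a b) (h' : Cr n R q' a b) : False := by
  rcases ltR_tri q q' with hl | hl | hl
  · exact uniq_aux hR hq' hq hl h' h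
  · exact hne hl
  · exact uniq_aux hR hq hq' hl h h'

theorem exists_first (R : Finset (ℤ × ℤ)) (hne : R.Nonempty) :
    ∃ q ∈ R, ∀ y ∈ R, y ≠ q → ltR q y := by
  have hs := Finset.pairwise_sort R rcOrder
  have hm : ∀ y, y ∈ R.sort rcOrder ↔ y ∈ R := fun y => Finset.mem_sort _
  cases hl : R.sort rcOrder with
  | nil =>
    obtain ⟨y, hy⟩ := hne
    have := (hm y).2 hy
    rw [hl] at this; simp at this
  | cons q l =>
    rw [hl] at hs hm
    refine ⟨q, (hm q).1 (by simp), fun y hy hyq => ?_⟩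
    have h1 := (hm y).2 hy
    rw [List.mem_cons] at h1
    have h2 := (List.pairwise_cons.1 hs).1 y (h1.resolve_left hyq)
    rcases ltR_tri q y with h | h | h
    · exact h
    · exact absurd h.symm hyq
    · unfold rcOrder at h2; unfold ltR at h; omega

theorem exists_cross (n : ℤ) (m : ℕ) : ∀ (R : Finset (ℤ × ℤ)), R.card = m → ∀ a b : ℤ, b < a →
    wR n R a < wR n R b → ∃ q ∈ R, lT n R q = a ∧ lF n R q = b := by
  induction m with
  | zero =>
    intro R hR a b hab h
    rw [Finset.card_eq_zero.1 hR, wR_empty] at h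
    simp at h; omega
  | succ m ih =>
    intro R hR a b hab h
    obtain ⟨q, hq, hf⟩ := exists_first R (Finset.card_pos.1 (by omega))
    have hb : bef R q = R.erase q := by
      ext y
      rw [mem_bef, Finset.mem_erase]
      constructor
      · rintro ⟨h1, h2⟩
        exact ⟨by rintro rfl; exact ltR_irrefl _ h2, h1⟩
      · rintro ⟨h1, h2⟩
        exact ⟨h2, hf y h2 h1⟩
    have he : (R.filter fun z => ltR z q) = ∅ := by
      apply Finset.filter_eq_empty_iff.2
      intro z hz hzq
      have : z ≠ q := by rintro rfl; exact ltR_irrefl _ hzq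
      exact ltR_irrefl _ (ltR_trans hzq (hf z hz this))
    have hw := wR_split n R q
    rw [he, wR_empty, one_mul, if_pos hq] at hw
    rw [hw, Equiv.Perm.mul_apply, Equiv.Perm.mul_apply] at h
    rcases lt_trichotomy (wR n (bef R q) a) (wR n (bef R q) b) with hlt | heq | hgt
    · have hc : (bef R q).card = m := by
        have := Finset.card_erase_add_one hq
        rw [hb]; omega
      obtain ⟨x, hx, h1, h2⟩ := ih _ hc a b hab hlt
      obtain ⟨hx1, hx2⟩ := mem_bef.1 hx
      exact ⟨x, hx1, by rw [← lT_bef n R hx2, h1], by rw [← lF_bef n R hx2, h2]⟩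
    · have := (wR n (bef R q)).injective heq
      omega
    · obtain ⟨h1, h2⟩ := sT_flip hgt h
      refine ⟨q, hq, ?_, ?_⟩
      · rw [lT, Equiv.symm_apply_eq, h2]
      · rw [lF, Equiv.symm_apply_eq, h1]

theorem cross_inv {n : ℤ} {R : Finset (ℤ × ℤ)} (hR : IsRC n R) {q : ℤ × ℤ} (hq : q ∈ R)
    {a b : ℤ} (hab : b < a) (h : Cr n R q a b) : wR n R a < wR n R b := by
  by_contra hcon
  have hne : wR n R b ≠ wR n R a := fun e => by
    have := (wR n R).injective e; omega
  have e := wR_erase n R hq h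
  obtain ⟨l, hl1, hl2⟩ := wR_word n (R.erase q)
  obtain ⟨l', h1, h2⟩ := exchange l a b hab (by
    rw [hl2, e, Equiv.Perm.mul_apply, Equiv.Perm.mul_apply, Equiv.swap_apply_left,
      Equiv.swap_apply_right]
    omega)
  rw [hl2, e, mul_assoc, Equiv.swap_mul_self, mul_one] at h2
  have h3 := len_le_of l'
  rw [h2, hR.2] at h3
  have h4 := Finset.card_erase_add_one hq
  omega

theorem isRC_bef {n : ℤ} {R : Finset (ℤ × ℤ)} (hR : IsRC n R) (y : ℤ × ℤ) :
    IsRC n (bef R y) := by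
  refine ⟨fun p hp => hR.1 p (mem_bef.1 hp).1, ?_⟩
  have hsub : bef R y ⊆ R := Finset.filter_subset _ _
  have hu : wR n R = wR n (R \ bef R y) * wR n (bef R y) := by
    rw [← wR_union, Finset.sdiff_union_of_subset hsub]
    intro u hu v hv
    rw [Finset.mem_sdiff, mem_bef] at hu
    have hv := (mem_bef.1 hv).2
    rcases ltR_tri u y with h | h | h
    · exact ltR_trans h hv
    · rw [h]; exact hv
    · exact absurd ⟨hu.1, h⟩ hu.2
  have hc := Finset.card_sdiff_add_card_eq_card hsub
  obtain ⟨l1, a1, a2⟩ := wR_word n (R \ bef R y)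
  obtain ⟨l2, b1, b2⟩ := len_word n (bef R y)
  have h3 := len_le_of (l1 ++ l2)
  rw [List.map_append, List.prod_append, a2, b2, ← hu, hR.2, List.length_append] at h3
  have h4 := len_wR_le n (bef R y)
  omega

theorem lT_ne_lF (n : ℤ) (R : Finset (ℤ × ℤ)) (q : ℤ × ℤ) : lT n R q ≠ lF n R q := by
  intro h
  have := (wR n (bef R q)).symm.injective h
  omega

theorem orient {n : ℤ} {R : Finset (ℤ × ℤ)} (hR : IsRC n R) {q : ℤ × ℤ} (hq : q ∈ R) :
    lF n R q < lT n R q := by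
  by_contra hcon
  have hne := lT_ne_lF n R q
  obtain ⟨x, hx, h1, h2⟩ := exists_cross n _ (bef R q) rfl (lF n R q) (lT n R q) (by omega) (by
    rw [lT, lF, Equiv.apply_symm_apply, Equiv.apply_symm_apply]; omega)
  obtain ⟨hx1, hx2⟩ := mem_bef.1 hx
  rw [lT_bef n R hx2] at h1
  rw [lF_bef n R hx2] at h2
  have hne : q ≠ x := by rintro rfl; exact ltR_irrefl _ hx2
  exact uniq hR hq hx1 hne (Or.inl ⟨rfl, rfl⟩) (Or.inr ⟨h1, h2⟩)

theorem not_cross_before {n : ℤ} {R : Finset (ℤ × ℤ)} (hR : IsRC n R) {p x : ℤ × ℤ}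
    (hx : x ∈ R) (hl : ltR p x) (hab : lF n R p < lT n R p)
    (h : Cr n R x (lT n R p) (lF n R p)) : False := by
  have h1 : Cr n (bef R p) x (lT n R p) (lF n R p) := by
    unfold Cr at *
    rw [lT_bef n R hl, lF_bef n R hl]; exact h
  have h2 := cross_inv (isRC_bef hR p) (mem_bef.2 ⟨hx, hl⟩) hab h1
  rw [lT, lF, Equiv.apply_symm_apply, Equiv.apply_symm_apply] at h2
  omega

/-! The insertion step -/

/-- `p` is an open space of `R`, in terms of `lT` and `lF`. -/
def Op (n : ℤ) (R : Finset (ℤ × ℤ)) (p : ℤ × ℤ) : Prop :=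
  p.1 ≤ n ∧ p ∉ R ∧ lF n R p ≤ 0 ∧ 0 < lT n R p

theorem openSpace_iff {n : ℤ} {R : Finset (ℤ × ℤ)} (hG : Good n R) (i k : ℤ) :
    OpenSpace n R i k ↔ Op n R (i, k) := by
  unfold OpenSpace Op
  constructor
  · rintro ⟨h1, h2, h3, h4⟩
    rw [lab_false n R hG i k h1] at h3
    rw [lab_true n R hG i k h1] at h4
    exact ⟨h1, h2, h3, h4⟩
  · rintro ⟨h1, h2, h3, h4⟩
    rw [lab_false n R hG i k h1, lab_true n R hG i k h1]
    exact ⟨h1, h2, h3, h4⟩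

theorem exists_open {n : ℤ} {R : Finset (ℤ × ℤ)} (hG : Good n R) {i k : ℤ} (hk : 1 ≤ k)
    (hi : i ≤ n) (h : lT n R (i, k) ≤ 0) : ∃ x, i < x ∧ Op n R (x, k) := by
  by_contra hcon
  push Not at hcon
  have key : ∀ m : ℕ, i + m ≤ n → lT n R (i + m, k) ≤ 0 := by
    intro m
    induction m with
    | zero => intro _; simpa using h
    | succ m ih =>
      intro hm
      push_cast at hm ⊢
      have h1 := ih (by omega)
      rw [lT_step] at h1
      rw [← add_assoc]
      split_ifs at h1 with h2
      · exact h1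
      · by_contra h3
        exact hcon (i + m + 1) (by omega) ⟨by dsimp only; omega, h2, h1, by omega⟩
  have h2 := key (n - i).toNat (by omega)
  have h3 : i + ((n - i).toNat : ℤ) = n := by omega
  rw [h3, lT_of_le n R hG k] at h2
  omega

theorem isRC_insert {n : ℤ} {R : Finset (ℤ × ℤ)} {p : ℤ × ℤ} (hR : IsRC n R) (hG : Good n (insert p R))
    (hp : p ∉ R) (hab : lF n R p < lT n R p)
    (h : wR n R (lF n R p) < wR n R (lT n R p)) : IsRC n (insert p R) := by
  refine ⟨fun x hx => ⟨(hG x hx).1, (hG x hx).2.2⟩, ?_⟩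
  by_contra hcon
  have h1 := len_wR_le n (insert p R)
  have h2 := Finset.card_insert_of_notMem hp
  obtain ⟨l, a1, a2⟩ := len_word n (insert p R)
  have e := wR_insert n R p hp
  obtain ⟨l', b1, b2⟩ := exchange l (lT n R p) (lF n R p) hab (by
    rw [a2, e, Equiv.Perm.mul_apply, Equiv.Perm.mul_apply, Equiv.swap_apply_left,
      Equiv.swap_apply_right]
    exact h)
  rw [a2, e, mul_assoc, Equiv.swap_mul_self, mul_one] at b2
  have h3 := len_le_of l'
  rw [b2, hR.2] at h3
  omega

theorem star_insert {n : ℤ} {R : Finset (ℤ × ℤ)} (hR : IsRC n R) (hS : Star n R) {p : ℤ × ℤ}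
    (hp : Op n R p) (hI : IsRC n (insert p R)) : Star n (insert p R) := by
  obtain ⟨_, hpR, hb, ha⟩ := hp
  have e := wR_insert n R p hpR
  have hcard := Finset.card_insert_of_notMem hpR
  have hlenI := hI.2
  have hlen := hR.2
  generalize lT n R p = a at *
  generalize lF n R p = b at *
  have hinj := (wR n R).injective
  have hba : wR n R b < wR n R a := by
    by_contra hcon
    have hne : wR n R b ≠ wR n R a := fun e => by have := hinj e; omega
    obtain ⟨l, a1, a2⟩ := wR_word n R
    obtain ⟨l', b1, b2⟩ := exchange l a b (by omega) (by rw [a2]; omega)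
    rw [a2, ← e] at b2
    have h3 := len_le_of l'
    rw [b2] at h3
    omega
  intro i hi
  rw [e, Equiv.Perm.mul_apply, Equiv.Perm.mul_apply]
  have hSi := hS i hi
  by_cases h1 : i = b
  · subst h1
    rw [Equiv.swap_apply_right, Equiv.swap_apply_of_ne_of_ne (by omega) (by omega)]
    omega
  by_cases h2 : i - 1 = b
  · have hic : i = b + 1 := by omega
    rw [h2, Equiv.swap_apply_right, Equiv.swap_apply_of_ne_of_ne (by omega) (by omega)]
    rw [h2] at hSi
    by_contra hcon
    have hne : wR n R i ≠ wR n R a := fun e => by have := hinj e; omega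
    have hia : i ≠ a := by omega
    have hba' : b ≠ a := by omega
    have hbi : b ≠ i := by omega
    obtain ⟨l, a1, a2⟩ := wR_word n (insert p R)
    rw [e] at a2
    obtain ⟨l1, b1, b2⟩ := exchange l i b (by omega) (by
      rw [a2]
      simp only [Equiv.Perm.mul_apply, Equiv.swap_apply_right,
        Equiv.swap_apply_of_ne_of_ne hia hbi.symm]
      omega)
    rw [a2] at b2
    obtain ⟨l2, c1, c2⟩ := exchange l1 a i (by omega) (by
      rw [b2]
      simp only [Equiv.Perm.mul_apply, Equiv.swap_apply_right, Equiv.swap_apply_left,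
        Equiv.swap_apply_of_ne_of_ne hia.symm hba'.symm]
      omega)
    rw [b2] at c2
    obtain ⟨l3, d1, d2⟩ := exchange l2 i b (by omega) (by
      rw [c2]
      simp only [Equiv.Perm.mul_apply, Equiv.swap_apply_right, Equiv.swap_apply_left,
        Equiv.swap_apply_of_ne_of_ne hia.symm hba'.symm,
        Equiv.swap_apply_of_ne_of_ne hia hbi.symm,
        Equiv.swap_apply_of_ne_of_ne hba' hbi]
      omega)
    rw [c2] at d2
    have e3 : wR n R * Equiv.swap a b * Equiv.swap i b * Equiv.swap a i * Equiv.swap i b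
        = wR n R := by
      ext z
      simp only [Equiv.Perm.mul_apply]
      congr 1
      simp only [Equiv.swap_apply_def]
      split_ifs <;> omega
    rw [e3] at d2
    have h3 := len_le_of l3
    rw [d2] at h3
    omega
  · rw [Equiv.swap_apply_of_ne_of_ne (by omega) (by omega),
      Equiv.swap_apply_of_ne_of_ne (by omega) (by omega)]
    exact hSi

theorem good_of_star {n : ℤ} {R : Finset (ℤ × ℤ)} (hR : IsRC n R) (hS : Star n R) :
    Good n R := by
  intro p hp
  refine ⟨(hR.1 p hp).1, ?_, (hR.1 p hp).2⟩
  by_contra hcon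
  obtain ⟨q, hq, hmin⟩ := Finset.exists_min_image R (fun x => (bef R x).card) ⟨p, hp⟩
  have hb : bef R q = ∅ := by
    by_contra hne
    obtain ⟨y, hy⟩ := Finset.nonempty_iff_ne_empty.2 hne
    obtain ⟨hy1, hy2⟩ := mem_bef.1 hy
    have : bef R y ⊂ bef R q := by
      refine (Finset.ssubset_iff_of_subset ?_).2 ⟨y, hy, fun h => ltR_irrefl _ (mem_bef.1 h).2⟩
      intro z hz
      exact mem_bef.2 ⟨(mem_bef.1 hz).1, ltR_trans hy2 (mem_bef.1 hz).2⟩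
    have h1 := Finset.card_lt_card this
    have h2 := hmin y hy1
    omega
  have hq2 : q.2 ≤ p.2 := by
    rcases ltR_tri p q with h | h | h
    · unfold ltR at h; omega
    · rw [h]
    · have := mem_bef.2 ⟨hp, h⟩
      rw [hb] at this; simp at this
  have hq1 := (hR.1 q hq).1
  have hc : Cr n R q (idx n q + 1) (idx n q) := by
    left
    unfold lT lF
    rw [hb, wR_empty]
    exact ⟨rfl, rfl⟩
  have h1 := cross_inv hR hq (by omega) hc
  have h2 := hS (idx n q + 1) (by unfold idx; omega)
  rw [add_sub_cancel_right] at h2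
  omega

theorem good_insert {n : ℤ} {R : Finset (ℤ × ℤ)} (hG : Good n R) {p : ℤ × ℤ} (h1 : p.1 ≤ n)
    (h2 : 1 ≤ p.2) (h3 : p.2 ≤ n) : Good n (insert p R) := by
  intro x hx
  rcases Finset.mem_insert.1 hx with rfl | hx
  · exact ⟨h1, h2, h3⟩
  · exact hG x hx

theorem cross_exists {n : ℤ} {R : Finset (ℤ × ℤ)} (hG : Good n R) (hR : IsRC n R) {p : ℤ × ℤ}
    (hp : Op n R p) (h2 : 1 ≤ p.2) (h3 : p.2 ≤ n) (hI : ¬ IsRC n (insert p R)) :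
    ∃ q ∈ insert p R, q ≠ p ∧ Cr n (insert p R) q (lT n R p) (lF n R p) := by
  obtain ⟨h1, hpR, hb, ha⟩ := hp
  have hlt : wR n R (lT n R p) < wR n R (lF n R p) := by
    by_contra hcon
    have hne : wR n R (lF n R p) ≠ wR n R (lT n R p) := fun e => by
      have := (wR n R).injective e; omega
    exact hI (isRC_insert hR (good_insert hG h1 h2 h3) hpR (by omega) (by omega))
  obtain ⟨q, hq, hqa, hqb⟩ := exists_cross n _ R rfl _ _ (by omega) hlt
  refine ⟨q, Finset.mem_insert_of_mem hq, by rintro rfl; exact hpR hq, ?_⟩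
  by_cases hl : ltR q p
  · right
    rw [lT_insert_later n R hl hpR, lF_insert_later n R hl hpR, hqa, hqb,
      Equiv.swap_apply_left, Equiv.swap_apply_right]
    exact ⟨rfl, rfl⟩
  · left
    rw [lT_insert_not n R hl, lF_insert_not n R hl]
    exact ⟨hqa, hqb⟩

theorem step_q {n : ℤ} {R : Finset (ℤ × ℤ)} (hG : Good n R) (hR : IsRC n R) (hS : Star n R)
    {p : ℤ × ℤ} (hp : Op n R p) (h2 : 1 ≤ p.2) (h3 : p.2 ≤ n) {q : ℤ × ℤ}
    (hq : q ∈ insert p R) (hqp : q ≠ p)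
    (hc : Cr n (insert p R) q (lT n R p) (lF n R p)) :
    p.2 < q.2 ∧ Good n ((insert p R).erase q) ∧ IsRC n ((insert p R).erase q) ∧
      Star n ((insert p R).erase q) ∧ lT n ((insert p R).erase q) q ≤ 0 := by
  obtain ⟨h1, hpR, hb, ha⟩ := hp
  have hGI := good_insert hG h1 h2 h3
  have hqR : q ∈ R := (Finset.mem_insert.1 hq).resolve_left hqp
  have hl : ltR q p := by
    rcases ltR_tri q p with h | h | h
    · exact h
    · exact absurd h hqp
    · exfalso
      have hnl : ¬ ltR q p := fun h' => ltR_irrefl _ (ltR_trans h h')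
      refine not_cross_before hR hqR h (by omega) ?_
      unfold Cr at *
      rwa [lT_insert_not n R hnl, lF_insert_not n R hnl] at hc
  have ho := orient hR hqR
  have hTI : lT n (insert p R) q = lF n R p := by
    rcases hc with hc | hc
    · exfalso
      rw [lT_insert_later n R hl hpR, lF_insert_later n R hl hpR] at hc
      have e1 := (Equiv.swap_apply_eq_iff.1 hc.1)
      have e2 := (Equiv.swap_apply_eq_iff.1 hc.2)
      rw [Equiv.swap_apply_left] at e1
      rw [Equiv.swap_apply_right] at e2
      omega
    · exact hc.1
  have hrow : p.2 < q.2 := by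
    by_contra hcon
    have hl' := hl
    unfold ltR at hl'
    have hs := wR_bef_split n (insert p R) hl
    rw [if_pos (Finset.mem_insert_self p R), bef_insert_not R (ltR_irrefl p)] at hs
    have hw : wR n (bef (insert p R) q) (lF n R p) = idx n p + 1 := by
      rw [hs, Equiv.Perm.mul_apply, Equiv.Perm.mul_apply, lF, Equiv.apply_symm_apply, sT,
        Equiv.swap_apply_left]
      apply wR_fix
      intro z hz
      rw [Finset.mem_filter] at hz
      unfold ltR at hz
      unfold idx
      omega
    rw [← hTI, lT, Equiv.apply_symm_apply] at hw
    unfold idx at hw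
    omega
  have hw : wR n ((insert p R).erase q) = wR n R := by
    rw [wR_erase n _ hq hc, wR_insert n R p hpR, mul_assoc, Equiv.swap_mul_self, mul_one]
  have hG' : Good n ((insert p R).erase q) := fun x hx => hGI x (Finset.mem_of_mem_erase hx)
  refine ⟨hrow, hG', ⟨fun x hx => ⟨(hG' x hx).1, (hG' x hx).2.2⟩, ?_⟩, ?_, ?_⟩
  · rw [hw, hR.2]
    have c1 := Finset.card_erase_add_one hq
    have c2 := Finset.card_insert_of_notMem hpR
    omega
  · unfold Star; rw [hw]; exact hS
  · rw [← lT_insert_not n _ (ltR_irrefl q), Finset.insert_erase hq, hTI]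
    exact hb

theorem headI_mem (C : Finset (ℤ × ℤ)) (h : C.Nonempty) : (C.sort rcOrder).headI ∈ C := by
  obtain ⟨y, hy⟩ := h
  have hy := (Finset.mem_sort rcOrder).2 hy
  rw [← Finset.mem_sort rcOrder]
  cases hl : C.sort rcOrder with
  | nil => rw [hl] at hy; simp at hy
  | cons q l => simp

theorem steps_star (n : ℤ) (fuel : ℕ) : ∀ (R : Finset (ℤ × ℤ)) (p : ℤ × ℤ)
    (d : Finset (ℤ × ℤ) × (ℤ × ℤ)), Good n R → IsRC n R → Star n R → Op n R p → 1 ≤ p.2 →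
    p.2 ≤ n → n + 1 - p.2 ≤ fuel →
    Star n (((insertSteps n fuel (insert p R) p).getLast?.getD d).1) := by
  induction fuel with
  | zero =>
    intro R p d _ _ _ _ _ h3 hf
    push_cast at hf; omega
  | succ fuel ih =>
    intro R p d hG hR hS hp h2 h3 hf
    rw [insertSteps, List.getLast?_cons, Option.getD_some]
    by_cases hI : IsRC n (insert p R)
    · rw [if_pos hI]
      exact star_insert hR hS hp hI
    · rw [if_neg hI]
      have hGI := good_insert hG hp.1 h2 h3
      dsimp only
      have hla : lab n (insert p R) true p.1 p.2 = lT n R p := by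
        rw [lab_true n _ hGI _ _ hp.1]; exact lT_insert_not n R (ltR_irrefl p)
      have hlb : lab n (insert p R) false p.1 p.2 = lF n R p := by
        rw [lab_false n _ hGI _ _ hp.1]; exact lF_insert_not n R (ltR_irrefl p)
      rw [hla, hlb]
      generalize hC : (insert p R).filter (fun q =>
            q ≠ p ∧ ((lab n (insert p R) true q.1 q.2 = lT n R p ∧
                lab n (insert p R) false q.1 q.2 = lF n R p) ∨
              (lab n (insert p R) true q.1 q.2 = lF n R p ∧
                lab n (insert p R) false q.1 q.2 = lT n R p))) = C
      have hCm : ∀ q, q ∈ C ↔ q ∈ insert p R ∧ q ≠ p ∧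
          Cr n (insert p R) q (lT n R p) (lF n R p) := by
        intro q
        rw [← hC, Finset.mem_filter]
        apply and_congr_right
        intro hq
        rw [lab_true n _ hGI _ _ (hGI q hq).1, lab_false n _ hGI _ _ (hGI q hq).1]
        rfl
      obtain ⟨q0, hq0⟩ := cross_exists hG hR hp h2 h3 hI
      have hq := headI_mem C ⟨q0, (hCm q0).2 hq0⟩
      generalize (C.sort rcOrder).headI = q at hq
      obtain ⟨hqI, hqp, hqc⟩ := (hCm q).1 hq
      obtain ⟨hrow, hG', hR', hS', hT'⟩ := step_q hG hR hS hp h2 h3 hqI hqp hqc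
      have hgq := hGI q hqI
      generalize (insert p R).erase q = R' at *
      obtain ⟨x, hx1, hx2⟩ := exists_open (i := q.1) (k := q.2) hG' hgq.2.1 hgq.1 hT'
      have hmem := Int.csInf_mem (s := {x : ℤ | q.1 < x ∧ OpenSpace n R' x q.2})
        ⟨x, hx1, (openSpace_iff hG' x q.2).2 hx2⟩ ⟨q.1, fun y hy => le_of_lt hy.1⟩
      exact ih R' _ _ hG' hR' hS' ((openSpace_iff hG' _ _).1 hmem.2) hgq.2.1 hgq.2.2
        (by push_cast at hf; dsimp only; omega)

theorem far_right {n : ℤ} (R : Finset (ℤ × ℤ)) (k : ℤ) :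
    ∃ M : ℤ, ∀ i ≤ M, lT n R (i, k) ≤ 0 := by
  have hM : ∃ N : ℤ, ∀ p ∈ R, N ≤ idx n p := by
    obtain ⟨N, hN⟩ := (R.image (idx n)).bddBelow
    exact ⟨N, fun p hp => hN (by simpa using ⟨_, _, hp, rfl⟩)⟩
  obtain ⟨N, hN⟩ := hM
  refine ⟨min (N - 1) 0 + n - k, fun i hi => ?_⟩
  unfold lT
  have h0 : idx n (i, k) + 1 = i + k - n := by unfold idx; dsimp only; omega
  rw [h0, wR_fix_symm]
  · omega
  · intro p hp
    have := hN p (mem_bef.1 hp).1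
    omega

theorem insertOne_star_int (n : ℤ) (R : Finset (ℤ × ℤ))
    (hR : IsRC n R) (hS : Star n R) (k : ℤ) (hk1 : 1 ≤ k) (hkn : k ≤ n) :
    Star n (insertOne n R k) := by
  have hG := good_of_star hR hS
  obtain ⟨M, hM⟩ := far_right (n := n) R k
  obtain ⟨x, hx1, hx2⟩ := exists_open (i := min M n) (k := k) hG hk1 (by omega)
    (hM _ (by omega))
  have hmem := Int.csInf_mem (s := {x : ℤ | OpenSpace n R x k})
    ⟨x, (openSpace_iff hG x k).2 hx2⟩ ⟨M, fun y hy => by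
      by_contra hlt
      have h1 := hM y (by omega)
      have h2 := ((openSpace_iff hG y k).1 hy).2.2.2
      omega⟩
  unfold insertOne insertStepsOf
  exact steps_star n _ R _ _ hG hR hS ((openSpace_iff hG _ _).1 hmem) hk1 hkn
    (by push_cast; omega)

/-- If `R` is an rc-graph satisfying (*) and `1 ≤ k ≤ n`, then `R ← k`
also satisfies (*): `w_{R←k}(i) > w_{R←k}(i−1)` for all `i ≤ 0` (equivalently, no two
strands of `R ← k` with nonpositive labels intersect). -/
theorem insertOne_star (n : ℕ) (hn : 0 < n) (R : Finset (ℤ × ℤ))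
    (hR : IsRC n R) (hS : Star n R) (k : ℤ) (hk1 : 1 ≤ k) (hkn : k ≤ n) :
    Star n (insertOne n R k) := by
  exact insertOne_star_int n R hR hS k hk1 hkn

end RCGraphs
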